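/- Let X be a complex Banach space and let g : ℂ → X be continuous on the closed right half-plane {z : Re z ≥ 0}, complex-differentiable on the open right half-plane {z : Re z > 0}, and bounded there: ‖g(z)‖ ≤ M for all z with Re z ≥ 0. If g(n) = 0 for every nonnegative integer n, then there exists a constant γ ≥ 0 such that ‖g(z)‖ ≤ γ · |sin(π z)| · exp(−π |Im z|) for all z with Re z ≥ 0. -/

import Mathlib

open Complex Filter Topology Set in
/-- Division of a bounded function on the right half-plane by the Blaschke factor of one of its
zeros on the positive real axis, without increasing the bound. -/
theorem exists_eq_blaschke_smul_of_zero
    {E : Type*} [NormedAddCommGroup E] [NormedSpace ℂ E] [CompleteSpace E]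
    {f : ℂ → E} {M a : ℝ} (ha : 0 < a)
    (hf : DiffContOnCl ℂ f {z | 0 < z.re}) (hM : ∀ z : ℂ, 0 ≤ z.re → ‖f z‖ ≤ M)
    (hfa : f a = 0) :
    ∃ h : ℂ → E, DiffContOnCl ℂ h {z | 0 < z.re} ∧ (∀ z : ℂ, 0 ≤ z.re → ‖h z‖ ≤ M) ∧
      ∀ z : ℂ, 0 ≤ z.re → f z = ((z - a) / (z + a)) • h z := by
  have hopen : IsOpen {z : ℂ | 0 < z.re} := isOpen_lt continuous_const continuous_re
  have hmem : {z : ℂ | 0 < z.re} ∈ 𝓝 (a : ℂ) := hopen.mem_nhds (by simpa using ha)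
  have hne : ∀ z : ℂ, 0 ≤ z.re → z + a ≠ 0 := by
    intro z hz h
    have := congrArg re h
    simp at this
    linarith
  have hslope (z : ℂ) : (z - a) • dslope f a z = f z := by
    rw [sub_smul_dslope, hfa, sub_zero]
  have hnorm (z : ℂ) : ‖z - a‖ * ‖(z + a) • dslope f a z‖ = ‖z + a‖ * ‖f z‖ := by
    rw [← hslope z, norm_smul, norm_smul]
    ring
  have hd : DiffContOnCl ℂ (fun z : ℂ => (z + a) • dslope f a z) {z | 0 < z.re} := by
    refine ⟨?_, ?_⟩
    · exact (by fun_prop : DifferentiableOn ℂ (fun z : ℂ => z + a) _).smul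
        ((Complex.differentiableOn_dslope hmem).2 hf.differentiableOn)
    · exact (by fun_prop : ContinuousOn (fun z : ℂ => z + a) _).smul
        ((continuousOn_dslope (mem_of_superset hmem subset_closure)).2
          ⟨hf.continuousOn, hf.differentiableOn.differentiableAt hmem⟩)
  have hfar (z : ℂ) (hz : 0 ≤ z.re) (hza : 3 * a ≤ ‖z‖) :
      ‖(z + a) • dslope f a z‖ ≤ 2 * M := by
    have hna : ‖(a : ℂ)‖ = a := by simp [abs_of_pos ha]
    have h1 : ‖z‖ - a ≤ ‖z - a‖ := by
      simpa only [hna] using norm_sub_norm_le z (a : ℂ)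
    have h2 : ‖z + a‖ ≤ ‖z‖ + a := by simpa only [hna] using norm_add_le z (a : ℂ)
    have hpos : 0 < ‖z - a‖ := by linarith
    refine le_of_mul_le_mul_left ?_ hpos
    rw [hnorm]
    calc ‖z + a‖ * ‖f z‖ ≤ (2 * ‖z - a‖) * M :=
          mul_le_mul (by linarith) (hM z hz) (norm_nonneg _) (by positivity)
      _ = ‖z - a‖ * (2 * M) := by ring
  refine ⟨fun z => (z + a) • dslope f a z, hd, fun z hz => ?_, fun z hz => ?_⟩
  · refine PhragmenLindelof.right_half_plane_of_bounded_on_real hd ⟨0, by norm_num, 0, ?_⟩ ?_ ?_ hz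
    · refine Asymptotics.IsBigO.of_bound (2 * M) ?_
      filter_upwards [mem_inf_of_left
        ((tendsto_norm_cobounded_atTop (E := ℂ)).eventually_ge_atTop (3 * a)),
        mem_inf_of_right (mem_principal_self _)] with w hw hw'
      simpa using hfar w (le_of_lt hw') hw
    · refine isBoundedUnder_of_eventually_le (a := 2 * M) ?_
      filter_upwards [eventually_ge_atTop (3 * a)] with x hx
      have hx0 : 0 ≤ x := by linarith
      exact hfar x (by simpa using hx0) (by simpa [abs_of_nonneg hx0] using hx)
    · intro x
      have heq : ‖(x * I : ℂ) - a‖ = ‖(x * I : ℂ) + a‖ := by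
        simp [Complex.norm_def, normSq_apply]
      have hpos : 0 < ‖(x * I : ℂ) + a‖ := norm_pos_iff.2 (hne _ (by simp))
      have := hnorm (x * I)
      rw [heq] at this
      rw [mul_left_cancel₀ hpos.ne' this]
      exact hM _ (by simp)
  · rw [smul_smul, div_mul_cancel₀ _ (hne z hz), hslope]

open Complex in
/-- A bounded function on the right half-plane vanishing at the positive integers is dominated
by the Blaschke products of these zeros. -/
theorem norm_le_mul_prod_blaschke_of_vanishing_at_pos_nat
    {E : Type*} [NormedAddCommGroup E] [NormedSpace ℂ E] [CompleteSpace E]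
    {f : ℂ → E} {M : ℝ}
    (hf : DiffContOnCl ℂ f {z | 0 < z.re}) (hM : ∀ z : ℂ, 0 ≤ z.re → ‖f z‖ ≤ M)
    (hzero : ∀ n : ℕ, f (n + 1 : ℕ) = 0) (N : ℕ) {z : ℂ} (hz : 0 ≤ z.re) :
    ‖f z‖ ≤ M * ∏ n ∈ Finset.range N, ‖(z - (n + 1 : ℕ)) / (z + (n + 1 : ℕ))‖ := by
  have key : ∃ h : ℂ → E, DiffContOnCl ℂ h {z | 0 < z.re} ∧ (∀ z : ℂ, 0 ≤ z.re → ‖h z‖ ≤ M) ∧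
      ∀ z : ℂ, 0 ≤ z.re →
        f z = (∏ n ∈ Finset.range N, (z - (n + 1 : ℕ)) / (z + (n + 1 : ℕ))) • h z := by
    induction N with
    | zero => exact ⟨f, hf, hM, by simp⟩
    | succ N ih =>
      obtain ⟨h, hd, hb, he⟩ := ih
      have hN : h ((N + 1 : ℕ) : ℝ) = 0 := by
        have h0 := he ((N + 1 : ℕ) : ℂ) (by rw [natCast_re]; positivity)
        rw [hzero, eq_comm, smul_eq_zero] at h0
        rw [ofReal_natCast]
        refine h0.resolve_left (Finset.prod_ne_zero_iff.2 fun n hn => div_ne_zero ?_ ?_)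
        · have := Finset.mem_range.1 hn
          rw [sub_ne_zero]
          exact_mod_cast (by omega : N + 1 ≠ n + 1)
        · exact_mod_cast (by omega : N + 1 + (n + 1) ≠ 0)
      obtain ⟨h', hd', hb', he'⟩ := exists_eq_blaschke_smul_of_zero (by positivity) hd hb hN
      refine ⟨h', hd', hb', fun w hw => ?_⟩
      rw [he w hw, he' w hw, smul_smul, Finset.prod_range_succ, ofReal_natCast]
  obtain ⟨h, -, hb, he⟩ := key
  rw [he z hz, norm_smul, norm_prod, mul_comm]
  exact mul_le_mul_of_nonneg_right (hb z hz) (Finset.prod_nonneg fun _ _ => norm_nonneg _)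

open Complex in
/-- The Blaschke factor of a positive integer is quantitatively less than one. -/
theorem norm_blaschke_nat_le_exp {z : ℂ} (hz : 0 < z.re) (n : ℕ) :
    ‖(z - (n + 1 : ℕ)) / (z + (n + 1 : ℕ))‖ ≤
      Real.exp (-(2 * z.re / (‖z‖ + 1) ^ 2) * (1 / ((n : ℝ) + 1))) := by
  have hm : (1 : ℝ) ≤ (n : ℝ) + 1 := by simp
  have hpos : 0 < ‖z + (n + 1 : ℕ)‖ := norm_pos_iff.2 fun h => by
    have := congrArg re h
    simp at this
    linarith
  have hle : ‖z + (n + 1 : ℕ)‖ ≤ ((n : ℝ) + 1) * (‖z‖ + 1) := by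
    have h := norm_add_le z ((n + 1 : ℕ) : ℂ)
    rw [norm_natCast] at h
    push_cast at h ⊢
    nlinarith [norm_nonneg z]
  have hsub : ‖z - (n + 1 : ℕ)‖ ^ 2 = ‖z + (n + 1 : ℕ)‖ ^ 2 - 4 * z.re * ((n : ℝ) + 1) := by
    simp only [← normSq_eq_norm_sq, normSq_apply]
    simp
    ring
  refine le_of_sq_le_sq ?_ (Real.exp_pos _).le
  rw [norm_div, div_pow, hsub, sub_div, div_self (by positivity), ← Real.exp_nat_mul]
  refine le_trans ?_ (Real.add_one_le_exp _)
  have : 4 * z.re * ((n : ℝ) + 1) / (((n : ℝ) + 1) * (‖z‖ + 1)) ^ 2 ≤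
      4 * z.re * ((n : ℝ) + 1) / ‖z + (n + 1 : ℕ)‖ ^ 2 := by gcongr
  have e : 4 * z.re * ((n : ℝ) + 1) / (((n : ℝ) + 1) * (‖z‖ + 1)) ^ 2 =
      2 * (2 * z.re / (‖z‖ + 1) ^ 2 * (1 / ((n : ℝ) + 1))) := by
    have := norm_nonneg z
    field_simp
    ring
  push_cast at *
  linarith

open Complex Filter Topology in
/-- A bounded function on the right half-plane vanishing at the positive integers is zero. -/
theorem eqOn_zero_of_bounded_of_vanishing_at_pos_nat
    {E : Type*} [NormedAddCommGroup E] [NormedSpace ℂ E] [CompleteSpace E]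
    {f : ℂ → E} {M : ℝ}
    (hf : DiffContOnCl ℂ f {z | 0 < z.re}) (hM : ∀ z : ℂ, 0 ≤ z.re → ‖f z‖ ≤ M)
    (hzero : ∀ n : ℕ, f (n + 1 : ℕ) = 0) : Set.EqOn f 0 {z | 0 ≤ z.re} := by
  have hM0 : 0 ≤ M := (norm_nonneg _).trans (hM 0 le_rfl)
  have hint : Set.EqOn f 0 {z | 0 < z.re} := by
    intro z (hz : 0 < z.re)
    set c := 2 * z.re / (‖z‖ + 1) ^ 2
    have hc0 : 0 < c := by positivity
    have hlim : Tendsto (fun N : ℕ => M * Real.exp (-c * ∑ n ∈ Finset.range N,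
        1 / ((n : ℝ) + 1))) atTop (𝓝 (M * 0)) :=
      (Real.tendsto_exp_atBot.comp
        (Real.tendsto_sum_range_one_div_nat_succ_atTop.const_mul_atTop_of_neg
          (neg_lt_zero.2 hc0))).const_mul M
    rw [mul_zero] at hlim
    refine norm_le_zero_iff.1 (ge_of_tendsto' hlim fun N => ?_)
    refine (norm_le_mul_prod_blaschke_of_vanishing_at_pos_nat hf hM hzero N hz.le).trans ?_
    rw [Finset.mul_sum, Real.exp_sum]
    gcongr with n _
    exact norm_blaschke_nat_le_exp hz n
  rw [← closure_setOfPred_lt_re]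
  exact hint.of_subset_closure hf.continuousOn continuousOn_const subset_closure subset_rfl

/-- Let `g : ℂ → X` be continuous on the closed right half-plane, holomorphic on the open
right half-plane, bounded by `M` there, and vanishing at every nonnegative integer. Then
there is a constant `γ ≥ 0` with `‖g z‖ ≤ γ · |sin (π z)| · exp (-π |Im z|)` on the closed
right half-plane. -/
theorem bound_by_sine_of_vanishing_at_naturals
    {X : Type*} [NormedAddCommGroup X] [NormedSpace ℂ X] [CompleteSpace X]
    (g : ℂ → X)
    (hcont : ContinuousOn g {z : ℂ | 0 ≤ z.re})
    (hdiff : DifferentiableOn ℂ g {z : ℂ | 0 < z.re})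
    (M : ℝ) (hbound : ∀ z : ℂ, 0 ≤ z.re → ‖g z‖ ≤ M)
    (hzero : ∀ n : ℕ, g (n : ℂ) = 0) :
    ∃ γ : ℝ, 0 ≤ γ ∧ ∀ z : ℂ, 0 ≤ z.re →
      ‖g z‖ ≤ γ * ‖Complex.sin ((Real.pi : ℂ) * z)‖ *
        Real.exp (-Real.pi * |z.im|) := by
  have hd : DiffContOnCl ℂ g {z : ℂ | 0 < z.re} :=
    ⟨hdiff, by rwa [Complex.closure_setOfPred_lt_re]⟩
  refine ⟨0, le_rfl, fun z hz => ?_⟩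
  simp [eqOn_zero_of_bounded_of_vanishing_at_pos_nat hd hbound (fun n => hzero (n + 1)) hz]
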